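/- Let G and H be groups, each containing at least one non-identity element. Then the free product G * H has infinitely many conjugacy classes, i.e. the type of conjugacy classes of G * H is infinite. -/

import Mathlib

namespace Monoid.CoprodI

section Monoid

variable {ι : Type*} {M : ι → Type*} [∀ i, Monoid (M i)] [∀ i, DecidableEq (M i)]

theorem Word.length_rcons_le {i : ι} (p : Word.Pair M i) :
    (Word.rcons p).toList.length ≤ p.tail.toList.length + 1 := by
  unfold Word.rcons
  split <;> simp [Word.cons]

theorem Word.length_tail_le {i : ι} (p : Word.Pair M i) :
    p.tail.toList.length ≤ (Word.rcons p).toList.length := by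
  unfold Word.rcons
  split <;> simp [Word.cons]

variable [DecidableEq ι]

theorem Word.length_of_smul_le {i : ι} (m : M i) (w : Word M) :
    (of m • w).toList.length ≤ w.toList.length + 1 := by
  have hw : Word.rcons (Word.equivPair i w) = w := (Word.equivPair i).symm_apply_apply w
  rw [Word.of_smul_def]
  refine (Word.length_rcons_le _).trans (Nat.succ_le_succ ?_)
  calc (Word.equivPair i w).tail.toList.length
      ≤ (Word.rcons (Word.equivPair i w)).toList.length := Word.length_tail_le _
    _ = w.toList.length := by rw [hw]

theorem Word.length_prod_smul_le (v w : Word M) :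
    (v.prod • w).toList.length ≤ v.toList.length + w.toList.length := by
  induction v using Word.consRecOn with
  | empty => simp
  | cons i m v h1 h2 ih =>
    rw [Word.prod_cons, mul_smul]
    refine (Word.length_of_smul_le m _).trans ?_
    simp only [Word.cons, List.length_cons]
    omega

/-- The number of syllables of the reduced word representing an element of a free product. -/
def syllableLength (x : CoprodI M) : ℕ := (Word.equiv x).toList.length

theorem syllableLength_eq_length_smul_empty (x : CoprodI M) :
    syllableLength x = (x • (Word.empty : Word M)).toList.length := rfl

theorem syllableLength_mul_le (x y : CoprodI M) :
    syllableLength (x * y) ≤ syllableLength x + syllableLength y := by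
  have h := Word.length_prod_smul_le (Word.equiv x) (Word.equiv y)
  have hx : (Word.equiv x).prod = x := Word.equiv.symm_apply_apply x
  rw [hx] at h
  rwa [syllableLength_eq_length_smul_empty, mul_smul]

theorem fstIdx_and_length_pow_smul_empty {i j : ι} (hij : i ≠ j) {g : M i} {h : M j}
    (hg : g ≠ 1) (hh : h ≠ 1) (n : ℕ) :
    ((of g * of h) ^ n • (Word.empty : Word M)).fstIdx ≠ some j ∧
      ((of g * of h) ^ n • (Word.empty : Word M)).toList.length = 2 * n := by
  induction n with
  | zero => simp [Word.fstIdx, Word.empty]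
  | succ n ih =>
    obtain ⟨hfst, hlen⟩ := ih
    rw [pow_succ', mul_smul, mul_smul]
    generalize (of g * of h) ^ n • (Word.empty : Word M) = w at hfst hlen ⊢
    have hfst' : (Word.cons h w hfst hh).fstIdx ≠ some i := by
      simpa using hij.symm
    rw [← Word.cons_eq_smul (h1 := hfst) (h2 := hh),
      ← Word.cons_eq_smul (h1 := hfst') (h2 := hg)]
    refine ⟨by simpa using hij, ?_⟩
    simp only [Word.cons, List.length_cons, hlen]
    ring

theorem syllableLength_of_mul_of_pow {i j : ι} (hij : i ≠ j) {g : M i} {h : M j}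
    (hg : g ≠ 1) (hh : h ≠ 1) (n : ℕ) :
    syllableLength ((of g * of h) ^ n) = 2 * n :=
  (fstIdx_and_length_pow_smul_empty hij hg hh n).2

end Monoid

section Group

variable {ι : Type*} {M : ι → Type*} [∀ i, Group (M i)]

theorem le_of_isConj_of_mul_of_pow {i j : ι} (hij : i ≠ j) {g : M i} {h : M j}
    (hg : g ≠ 1) (hh : h ≠ 1) {m n : ℕ}
    (hc : IsConj ((of g * of h) ^ m) ((of g * of h) ^ n)) : n ≤ m := by
  classical
  obtain ⟨u, hu⟩ := isConj_iff.1 hc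
  set k := syllableLength u + syllableLength u⁻¹ + 1
  have hpow : u * (of g * of h) ^ (m * k) * u⁻¹ = (of g * of h) ^ (n * k) := by
    rw [pow_mul, pow_mul, ← hu, conj_pow]
  have h1 := syllableLength_mul_le (u * (of g * of h) ^ (m * k)) u⁻¹
  have h2 := syllableLength_mul_le u ((of g * of h) ^ (m * k))
  rw [hpow, syllableLength_of_mul_of_pow hij hg hh] at h1
  rw [syllableLength_of_mul_of_pow hij hg hh] at h2
  by_contra! hlt
  have h3 : (m + 1) * k ≤ n * k := Nat.mul_le_mul_right k hlt
  rw [add_mul] at h3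
  omega

theorem isConj_pow_iff {i j : ι} (hij : i ≠ j) {g : M i} {h : M j}
    (hg : g ≠ 1) (hh : h ≠ 1) {m n : ℕ} :
    IsConj ((of g * of h) ^ m) ((of g * of h) ^ n) ↔ m = n :=
  ⟨fun hc => le_antisymm (le_of_isConj_of_mul_of_pow hij hg hh hc.symm)
    (le_of_isConj_of_mul_of_pow hij hg hh hc),
    fun hmn => hmn ▸ IsConj.refl _⟩

end Group

end Monoid.CoprodI

namespace Monoid.Coprod

universe u v

/-- Two groups, lifted to a common universe, as a family indexed by `Bool`. -/
def boolFamily (G : Type u) (H : Type v) : Bool → Type (max u v)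
  | true => ULift.{v} G
  | false => ULift.{u} H

instance (G : Type u) (H : Type v) [Group G] [Group H] (b : Bool) :
    Group (boolFamily G H b) :=
  match b with
  | true => inferInstanceAs (Group (ULift.{v} G))
  | false => inferInstanceAs (Group (ULift.{u} H))

/-- The comparison map from the binary free product to the free product of the family. -/
def toCoprodI (G : Type u) (H : Type v) [Group G] [Group H] :
    Coprod G H →* CoprodI (boolFamily G H) :=
  lift
    ((CoprodI.of (M := boolFamily G H) (i := true)).comp
      (MulEquiv.ulift.{u, v} (α := G)).symm.toMonoidHom)
    ((CoprodI.of (M := boolFamily G H) (i := false)).comp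
      (MulEquiv.ulift.{v, u} (α := H)).symm.toMonoidHom)

theorem isConj_pow_iff {G : Type u} {H : Type v} [Group G] [Group H] {g : G} {h : H}
    (hg : g ≠ 1) (hh : h ≠ 1) {m n : ℕ} :
    IsConj ((inl g * inr h : Coprod G H) ^ m) ((inl g * inr h) ^ n) ↔ m = n := by
  refine ⟨fun hc => ?_, fun hmn => hmn ▸ IsConj.refl _⟩
  have hg' : (ULift.up g : boolFamily G H true) ≠ 1 := fun e => hg (congrArg ULift.down e)
  have hh' : (ULift.up h : boolFamily G H false) ≠ 1 := fun e => hh (congrArg ULift.down e)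
  have hmap : toCoprodI G H (inl g * inr h) =
      CoprodI.of (M := boolFamily G H) (i := true) (ULift.up g) *
        CoprodI.of (M := boolFamily G H) (i := false) (ULift.up h) := by
    rw [map_mul, toCoprodI, lift_apply_inl, lift_apply_inr]
    rfl
  have hc' := (toCoprodI G H).map_isConj hc
  rw [map_pow, map_pow, hmap] at hc'
  exact (CoprodI.isConj_pow_iff (by decide) hg' hh').1 hc'

end Monoid.Coprod

/-- If `G` and `H` are groups each containing a non-identity element, then the free
product `G ∗ H` (the coproduct of groups) has infinitely many conjugacy classes. -/
theorem freeProduct_infinite_conjClasses (G H : Type*) [Group G] [Group H]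
    (hG : ∃ g : G, g ≠ 1) (hH : ∃ h : H, h ≠ 1) :
    Infinite (ConjClasses (Monoid.Coprod G H)) := by
  obtain ⟨g, hg⟩ := hG
  obtain ⟨h, hh⟩ := hH
  refine Infinite.of_injective
    (fun n : ℕ => ConjClasses.mk ((Monoid.Coprod.inl g * Monoid.Coprod.inr h) ^ n)) ?_
  intro m n hmn
  exact (Monoid.Coprod.isConj_pow_iff hg hh).1 (ConjClasses.mk_eq_mk_iff_isConj.1 hmn)
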